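/- arXiv:0802.4312 — 2 statements merged into one kernel-verified Lean document; each statement's English description precedes it below -/
import Mathlib

section
/- Let Γ ⊆ ℝⁿ be a simple rectifiable curve and for ε > 0 and points p₁, p₂ ∈ Γ(ε) define L(Γ, ε, p₁, p₂) = inf{ H¹(Γ') : Γ' simple rectifiable, Γ' ⊆ Γ(ε), p₁, p₂ ∈ Γ' }. Then lim_{ε → 0⁺} sup_{p₁,p₂ ∈ Γ(ε)} L(Γ, ε, p₁, p₂) = H¹(Γ). -/
open Set Metric Filter MeasureTheory ENNReal

def IsSimpleRectifiableCurve {n : ℕ} (Γ : Set (EuclideanSpace ℝ (Fin n))) : Prop :=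
  (∃ γ : ℝ → EuclideanSpace ℝ (Fin n),
      ContinuousOn γ (Icc 0 1) ∧ InjOn γ (Icc 0 1) ∧ γ '' Icc 0 1 = Γ) ∧
  μH[1] Γ < ⊤

noncomputable def sausageLength {n : ℕ} (Γ : Set (EuclideanSpace ℝ (Fin n)))
    (ε : ℝ) (p₁ p₂ : EuclideanSpace ℝ (Fin n)) : ℝ≥0∞ :=
  sInf { L : ℝ≥0∞ | ∃ Γ' : Set (EuclideanSpace ℝ (Fin n)),
    IsSimpleRectifiableCurve Γ' ∧ Γ' ⊆ cthickening ε Γ ∧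
    p₁ ∈ Γ' ∧ p₂ ∈ Γ' ∧ L = μH[1] Γ' }

theorem eventually_cthickening_inter_cthickening_inter_eq_empty {X : Type*} [MetricSpace X]
    [ProperSpace X] {K L W : Set X} (hK : IsCompact K) (hL : IsClosed L) (hW : IsClosed W)
    (h : K ∩ L ∩ W = ∅) :
    ∀ᶠ ε : ℝ in nhdsWithin 0 (Ioi 0), cthickening ε K ∩ cthickening ε L ∩ W = ∅ := by
  have hT : IsCompact (cthickening 1 K ∩ W) := hK.cthickening.inter_right hW
  have hf : Continuous fun x => infEDist x K + infEDist x L :=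
    continuous_infEDist.add continuous_infEDist
  have hone : ∀ᶠ ε : ℝ in nhdsWithin 0 (Ioi 0), ε < 1 :=
    nhdsWithin_le_nhds (gt_mem_nhds one_pos)
  rcases (cthickening 1 K ∩ W).eq_empty_or_nonempty with hemp | hne
  · filter_upwards [hone] with ε hε
    refine eq_empty_of_forall_notMem fun x hx => ?_
    exact notMem_empty x (hemp ▸ ⟨cthickening_mono hε.le K hx.1.1, hx.2⟩)
  · obtain ⟨y, hyT, hy⟩ := hT.exists_isMinOn hne hf.continuousOn
    have hpos : 0 < infEDist y K + infEDist y L := by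
      rw [pos_iff_ne_zero]
      intro h0
      obtain ⟨h1, h2⟩ := add_eq_zero.1 h0
      have : y ∈ K ∩ L ∩ W :=
        ⟨⟨(mem_iff_infEDist_zero_of_closed hK.isClosed).2 h1,
          (mem_iff_infEDist_zero_of_closed hL).2 h2⟩, hyT.2⟩
      exact notMem_empty y (h ▸ this)
    have hlim : Tendsto (fun ε : ℝ => ENNReal.ofReal ε + ENNReal.ofReal ε)
        (nhdsWithin 0 (Ioi 0)) (nhds 0) := by
      have : Tendsto (fun ε : ℝ => ENNReal.ofReal ε + ENNReal.ofReal ε)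
          (nhds 0) (nhds (ENNReal.ofReal 0 + ENNReal.ofReal 0)) :=
        (ENNReal.continuous_ofReal.add ENNReal.continuous_ofReal).tendsto 0
      simp only [ENNReal.ofReal_zero, add_zero] at this
      exact this.mono_left nhdsWithin_le_nhds
    filter_upwards [hone, hlim.eventually_lt_const hpos] with ε hε hlt
    refine eq_empty_of_forall_notMem fun x hx => ?_
    have hmin := hy ⟨cthickening_mono hε.le K hx.1.1, hx.2⟩
    exact (hmin.trans (add_le_add hx.1.1 hx.1.2)).not_gt hlt

/-- A connected set joining the endpoints of an arc inside a thin neighbourhood of it contains, near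
each subarc, a piece of length almost the distance between the endpoints of that subarc, and this
piece stays away from the preceding part of the arc. -/
theorem eventually_le_hausdorffMeasure_near_subarc {X : Type*} [MetricSpace X] [ProperSpace X]
    [MeasurableSpace X] [BorelSpace X] {γ : ℝ → X} (hc : ContinuousOn γ (Icc 0 1))
    (hi : InjOn γ (Icc 0 1)) {s t : ℝ} (hs : 0 ≤ s) (hst : s ≤ t) (ht : t ≤ 1)
    {δ : ℝ} (hδ : 0 < δ) :
    ∀ᶠ ε : ℝ in nhdsWithin 0 (Ioi 0),
      (∀ C : Set X, IsPreconnected C → C ⊆ cthickening ε (γ '' Icc 0 1) → γ 0 ∈ C → γ 1 ∈ C →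
        ENNReal.ofReal (dist (γ s) (γ t) - 2 * δ) ≤
          μH[1] (C ∩ (cthickening ε (γ '' Icc s t) ∩
            (dist · (γ s)) ⁻¹' Ioo δ (dist (γ s) (γ t) - δ)))) ∧
      Disjoint (cthickening ε (γ '' Icc 0 s)) (cthickening ε (γ '' Icc s t) ∩
            (dist · (γ s)) ⁻¹' Ioo δ (dist (γ s) (γ t) - δ)) := by
  set d := dist (γ s) (γ t) with hd
  have hcomp : ∀ a b, 0 ≤ a → b ≤ 1 → IsCompact (γ '' Icc a b) := fun a b ha hb =>
    isCompact_Icc.image_of_continuousOn (hc.mono (Icc_subset_Icc ha hb))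
  have hdist : Continuous fun x : X => dist x (γ s) := continuous_id.dist continuous_const
  have h1 := eventually_cthickening_inter_cthickening_inter_eq_empty (W := {x | δ ≤ dist x (γ s)})
    (hcomp 0 s le_rfl (hst.trans ht)) (hcomp s t hs ht).isClosed
    (isClosed_le continuous_const hdist) <| by
      refine eq_empty_of_forall_notMem ?_
      rintro _ ⟨⟨⟨a, ha, rfl⟩, b, hb, hab⟩, hx⟩
      have : b = a := hi ⟨hs.trans hb.1, hb.2.trans ht⟩ ⟨ha.1, ha.2.trans (hst.trans ht)⟩ hab
      have : a = s := le_antisymm ha.2 (this ▸ hb.1)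
      subst this
      simp only [mem_ofPred_eq, dist_self] at hx
      linarith
  rcases le_or_gt (d - δ) δ with hle | hlt
  · filter_upwards with ε
    refine ⟨fun C _ _ _ _ => ?_, by simp [Ioo_eq_empty hle.not_gt]⟩
    rw [ENNReal.ofReal_of_nonpos (by linarith)]
    exact zero_le
  have hst' : s < t := by
    refine hst.lt_of_ne fun h => ?_
    rw [h, dist_self] at hd
    linarith
  have h2 := eventually_cthickening_inter_cthickening_inter_eq_empty
    (W := {x | dist x (γ s) ≤ d - δ})
    (hcomp t 1 (hs.trans hst) le_rfl) (hcomp s t hs ht).isClosed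
    (isClosed_le hdist continuous_const) <| by
      refine eq_empty_of_forall_notMem ?_
      rintro _ ⟨⟨⟨a, ha, rfl⟩, b, hb, hab⟩, hx⟩
      have : b = a := hi ⟨hs.trans hb.1, hb.2.trans ht⟩ ⟨(hs.trans hst).trans ha.1, ha.2⟩ hab
      have : a = t := le_antisymm (this ▸ hb.2) ha.1
      subst this
      simp only [mem_ofPred_eq, dist_comm _ (γ s)] at hx
      linarith
  have h3 := eventually_cthickening_inter_cthickening_inter_eq_empty (W := univ)
    (hcomp 0 s le_rfl (hst.trans ht)) (hcomp t 1 (hs.trans hst) le_rfl).isClosed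
    isClosed_univ <| by
      refine eq_empty_of_forall_notMem ?_
      rintro _ ⟨⟨⟨a, ha, rfl⟩, b, hb, hab⟩, -⟩
      have : b = a := hi ⟨(hs.trans hst).trans hb.1, hb.2⟩ ⟨ha.1, ha.2.trans (hst.trans ht)⟩ hab
      linarith [ha.2, hb.1]
  filter_upwards [h1, h2, h3] with ε h1 h2 h3
  refine ⟨fun C hC hCΓ h0 h1C => ?_, Set.disjoint_left.2 fun x hx hx' =>
    notMem_empty x (h1 ▸ ⟨⟨hx, hx'.1⟩, hx'.2.1.le⟩)⟩
  set V := C ∩ (cthickening ε (γ '' Icc s t) ∩ (dist · (γ s)) ⁻¹' Ioo δ (d - δ)) with hV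
  have hsub : Ioo δ (d - δ) ⊆ (dist · (γ s)) '' V := by
    intro r hr
    have hcover : C ⊆ (cthickening ε (γ '' Icc 0 s) ∪
        (cthickening ε (γ '' Icc s t) ∩ {x | dist x (γ s) ≤ r})) ∪
        (cthickening ε (γ '' Icc t 1) ∪
        (cthickening ε (γ '' Icc s t) ∩ {x | r ≤ dist x (γ s)})) := by
      intro x hx
      have hx' := hCΓ hx
      rw [← Icc_union_Icc_eq_Icc hs (hst.trans ht), ← Icc_union_Icc_eq_Icc hst ht, image_union,
        image_union, cthickening_union, cthickening_union] at hx'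
      rcases hx' with h | h | h
      · exact Or.inl (Or.inl h)
      · rcases le_total (dist x (γ s)) r with hr | hr
        · exact Or.inl (Or.inr ⟨h, hr⟩)
        · exact Or.inr (Or.inr ⟨h, hr⟩)
      · exact Or.inr (Or.inl h)
    obtain ⟨x, hxC, hxA, hxB⟩ := isPreconnected_closed_iff.1 hC _ _
      (isClosed_cthickening.union
        (isClosed_cthickening.inter (isClosed_le hdist continuous_const)))
      (isClosed_cthickening.union
        (isClosed_cthickening.inter (isClosed_le continuous_const hdist))) hcover
      ⟨γ 0, h0, Or.inl (self_subset_cthickening _ ⟨0, ⟨le_rfl, hs⟩, rfl⟩)⟩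
      ⟨γ 1, h1C, Or.inl (self_subset_cthickening _ ⟨1, ⟨ht, le_rfl⟩, rfl⟩)⟩
    rcases hxA with hxA | ⟨hxA, hA⟩ <;> rcases hxB with hxB | ⟨hxB, hB⟩
    · exact (eq_empty_iff_forall_notMem.1 h3 x ⟨⟨hxA, hxB⟩, mem_univ x⟩).elim
    · exact (eq_empty_iff_forall_notMem.1 h1 x ⟨⟨hxA, hxB⟩, hr.1.le.trans hB⟩).elim
    · exact (eq_empty_iff_forall_notMem.1 h2 x ⟨⟨hxB, hxA⟩, le_trans hA hr.2.le⟩).elim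
    · have hxr : dist x (γ s) = r := le_antisymm hA hB
      exact ⟨x, ⟨hxC, hxA, by simpa [hxr] using hr⟩, hxr⟩
  calc ENNReal.ofReal (d - 2 * δ) = μH[1] (Ioo δ (d - δ)) := by
        rw [hausdorffMeasure_real, Real.volume_Ioo]; ring_nf
    _ ≤ μH[1] ((dist · (γ s)) '' V) := measure_mono hsub
    _ ≤ μH[1] V := by
        simpa using (LipschitzWith.dist_left (γ s)).hausdorffMeasure_image_le zero_le_one V

/-- The length of a curve is approximated from below by sums of distances between the endpoints of
finitely many consecutive subarcs. -/
theorem exists_lt_sum_dist_of_lt_hausdorffMeasure {X : Type*} [MetricSpace X]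
    [MeasurableSpace X] [BorelSpace X] {γ : ℝ → X} (hc : ContinuousOn γ (Icc 0 1))
    {c : ℝ≥0∞} (h : c < μH[1] (γ '' Icc 0 1)) :
    ∃ (N : ℕ) (s t : Fin N → ℝ), (∀ i, 0 ≤ s i ∧ s i ≤ t i ∧ t i ≤ 1) ∧
      (∀ i j, i < j → t i ≤ s j) ∧ c < ENNReal.ofReal (∑ i, dist (γ (s i)) (γ (t i))) := by
  let T : (N : ℕ) → Fin (N + 1) → Set X := fun N i =>
    γ '' Icc ((i : ℝ) / (N + 1)) (((i : ℝ) + 1) / (N + 1))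
  have hsub : ∀ (N : ℕ) (i : Fin (N + 1)),
      Icc ((i : ℝ) / (N + 1)) (((i : ℝ) + 1) / (N + 1)) ⊆ Icc 0 1 := by
    intro N i
    refine Icc_subset_Icc (by positivity) ?_
    rw [div_le_one (by positivity)]
    exact_mod_cast i.2
  have hr : Tendsto (fun N => ⨆ i, ediam (T N i)) atTop (nhds 0) := by
    rw [ENNReal.tendsto_nhds_zero]
    intro e he
    obtain ⟨η, hη, hunif⟩ := EMetric.uniformContinuousOn_iff.1
      (isCompact_Icc.uniformContinuousOn_of_continuous hc) e he
    have hsmall : Tendsto (fun N : ℕ => ENNReal.ofReal (1 / ((N : ℝ) + 1))) atTop (nhds 0) := by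
      simpa using ENNReal.tendsto_ofReal tendsto_one_div_add_atTop_nhds_zero_nat
    filter_upwards [hsmall.eventually_lt_const hη] with N hN
    refine iSup_le fun i => ediam_le ?_
    rintro _ ⟨a, ha, rfl⟩ _ ⟨b, hb, rfl⟩
    refine (hunif (hsub N i ha) (hsub N i hb) (lt_of_le_of_lt ?_ hN)).le
    rw [edist_dist]
    refine ENNReal.ofReal_le_ofReal ((Real.dist_le_of_mem_Icc ha hb).trans (le_of_eq ?_))
    ring
  have hcov : ∀ N, γ '' Icc 0 1 ⊆ ⋃ i, T N i := by
    rintro N _ ⟨a, ha, rfl⟩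
    have hN : (0 : ℝ) < N + 1 := by positivity
    rcases ha.2.eq_or_lt with rfl | ha1
    · refine mem_iUnion.2 ⟨Fin.last N, 1, ⟨?_, ?_⟩, rfl⟩
      · rw [div_le_one hN]; simp
      · rw [le_div_iff₀ hN]; simp
    · have hnn : 0 ≤ a * (N + 1) := mul_nonneg ha.1 hN.le
      have hlt : ⌊a * (N + 1)⌋₊ < N + 1 := by
        rw [Nat.floor_lt hnn]; push_cast; nlinarith
      refine mem_iUnion.2 ⟨⟨_, hlt⟩, a, ⟨?_, ?_⟩, rfl⟩
      · rw [div_le_iff₀ hN]; exact Nat.floor_le hnn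
      · rw [le_div_iff₀ hN]; exact (Nat.lt_floor_add_one _).le
  have hlim := Measure.hausdorffMeasure_le_liminf_sum 1 (γ '' Icc 0 1)
    (fun N => ⨆ i, ediam (T N i)) hr T (Eventually.of_forall fun N i => le_iSup (ediam <| T N ·) i)
    (Eventually.of_forall hcov)
  obtain ⟨N, hN⟩ := (eventually_lt_of_lt_liminf (h.trans_le hlim)).exists
  have hex : ∀ i : Fin (N + 1), ∃ s t, (i : ℝ) / (N + 1) ≤ s ∧ s ≤ t ∧
      t ≤ ((i : ℝ) + 1) / (N + 1) ∧ ediam (T N i) ≤ ENNReal.ofReal (dist (γ s) (γ t)) := by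
    intro i
    have hcI := hc.mono (hsub N i)
    have hne : (Icc ((i : ℝ) / (N + 1)) (((i : ℝ) + 1) / (N + 1))).Nonempty :=
      nonempty_Icc.2 (by gcongr; linarith)
    obtain ⟨⟨a, b⟩, ⟨ha, hb⟩, hmax⟩ := (isCompact_Icc.prod isCompact_Icc).exists_isMaxOn
      (hne.prod hne) (f := fun p : ℝ × ℝ => dist (γ p.1) (γ p.2))
      (continuous_dist.comp_continuousOn
        ((hcI.comp continuousOn_fst fun _ hx => hx.1).prodMk
          (hcI.comp continuousOn_snd fun _ hx => hx.2)))
    have hdiam : ediam (T N i) ≤ ENNReal.ofReal (dist (γ a) (γ b)) := by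
      refine ediam_le ?_
      rintro _ ⟨a', ha', rfl⟩ _ ⟨b', hb', rfl⟩
      rw [edist_dist]
      exact ENNReal.ofReal_le_ofReal (hmax (mk_mem_prod ha' hb'))
    rcases le_total a b with hab | hab
    · exact ⟨a, b, ha.1, hab, hb.2, hdiam⟩
    · exact ⟨b, a, hb.1, hab, ha.2, dist_comm (γ a) _ ▸ hdiam⟩
  choose s t hs hst ht hdiam using hex
  refine ⟨N + 1, s, t, fun i => ⟨?_, hst i, ?_⟩, fun i j hij => ?_, ?_⟩
  · exact (hsub N i ⟨hs i, (hst i).trans (ht i)⟩).1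
  · exact (hsub N i ⟨(hs i).trans (hst i), ht i⟩).2
  · refine (ht i).trans (le_trans ?_ (hs j))
    gcongr
    exact_mod_cast hij
  · rw [ENNReal.ofReal_sum_of_nonneg fun _ _ => dist_nonneg]
    refine hN.trans_le (Finset.sum_le_sum fun i _ => ?_)
    simpa using hdiam i

/-- Connected sets joining the endpoints of an arc inside a thin neighbourhood of it are almost as
long as the arc. -/
theorem exists_gt_eventually_le_hausdorffMeasure_of_isPreconnected {X : Type*} [MetricSpace X]
    [ProperSpace X] [MeasurableSpace X] [BorelSpace X] {γ : ℝ → X}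
    (hc : ContinuousOn γ (Icc 0 1)) (hi : InjOn γ (Icc 0 1)) {c : ℝ≥0∞}
    (h : c < μH[1] (γ '' Icc 0 1)) :
    ∃ c' > c, ∀ᶠ ε : ℝ in nhdsWithin 0 (Ioi 0), ∀ C : Set X, IsClosed C → IsPreconnected C →
      C ⊆ cthickening ε (γ '' Icc 0 1) → γ 0 ∈ C → γ 1 ∈ C → c' ≤ μH[1] C := by
  obtain ⟨N, s, t, hmem, hord, hlt⟩ := exists_lt_sum_dist_of_lt_hausdorffMeasure hc h
  set D := ∑ i, dist (γ (s i)) (γ (t i)) with hD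
  have hctop : c ≠ ⊤ := h.ne_top
  have hcD : c.toReal < D := (ENNReal.lt_ofReal_iff_toReal_lt hctop).1 hlt
  set δ := (D - c.toReal) / (4 * (N + 1)) with hδ
  have hN : (0 : ℝ) < 4 * (N + 1) := by positivity
  have hδpos : 0 < δ := div_pos (sub_pos.2 hcD) hN
  have hδN : δ * (4 * (N + 1)) = D - c.toReal := div_mul_cancel₀ _ hN.ne'
  refine ⟨ENNReal.ofReal (∑ i, (dist (γ (s i)) (γ (t i)) - 2 * δ)), ?_, ?_⟩
  · rw [gt_iff_lt, ENNReal.lt_ofReal_iff_toReal_lt hctop, Finset.sum_sub_distrib, ← hD]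
    simp only [Finset.sum_const, Finset.card_univ, Fintype.card_fin, nsmul_eq_mul]
    nlinarith
  have hev := eventually_all.2 fun i => eventually_le_hausdorffMeasure_near_subarc hc hi
    (hmem i).1 (hmem i).2.1 (hmem i).2.2 hδpos
  filter_upwards [hev] with ε hε C hCcl hC hCΓ h0 h1
  set V : Fin N → Set X := fun i => C ∩ (cthickening ε (γ '' Icc (s i) (t i)) ∩
    (dist · (γ (s i))) ⁻¹' Ioo δ (dist (γ (s i)) (γ (t i)) - δ)) with hV
  have hdisj' : ∀ i j, i < j → Disjoint (V i) (V j) := by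
    intro i j hij
    refine (hε j).2.mono (fun x hx => ?_) inter_subset_right
    exact cthickening_subset_of_subset ε
      (image_mono (Icc_subset_Icc (hmem i).1 (hord i j hij))) hx.2.1
  have hdisj : Pairwise (Function.onFun Disjoint V) := fun i j hij =>
    hij.lt_or_gt.elim (hdisj' i j) fun hji => (hdisj' j i hji).symm
  have hmeas : ∀ i, MeasurableSet (V i) := fun i =>
    hCcl.measurableSet.inter (isClosed_cthickening.measurableSet.inter
      ((continuous_id.dist continuous_const).measurable measurableSet_Ioo))
  calc ENNReal.ofReal (∑ i, (dist (γ (s i)) (γ (t i)) - 2 * δ))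
      ≤ ∑ i, ENNReal.ofReal (dist (γ (s i)) (γ (t i)) - 2 * δ) :=
        Finset.le_sum_of_subadditive _ ENNReal.ofReal_zero.le
          (fun _ _ => ENNReal.ofReal_add_le) _ _
    _ ≤ ∑ i, μH[1] (V i) := Finset.sum_le_sum fun i _ => (hε i).1 C hC hCΓ h0 h1
    _ = μH[1] (⋃ i, V i) := by rw [measure_iUnion hdisj hmeas, tsum_fintype]
    _ ≤ μH[1] C := measure_mono (iUnion_subset fun i => inter_subset_left)

/-- `A` is a simple arc from `a` to `b`, possibly degenerated to a point. -/
def IsArcBetween {X : Type*} [TopologicalSpace X] (A : Set X) (a b : X) : Prop :=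
  ∃ (u v : ℝ) (γ : ℝ → X), u ≤ v ∧ ContinuousOn γ (Icc u v) ∧ InjOn γ (Icc u v) ∧
    γ u = a ∧ γ v = b ∧ γ '' Icc u v = A

theorem IsArcBetween.union {X : Type*} [TopologicalSpace X] {A B : Set X} {a b c : X}
    (hA : IsArcBetween A a b) (hB : IsArcBetween B b c) (hAB : A ∩ B ⊆ {b}) :
    IsArcBetween (A ∪ B) a c := by
  obtain ⟨u, v, f, huv, hfc, hfi, rfl, hfv, rfl⟩ := hA
  obtain ⟨u', v', g, huv', hgc, hgi, hgu, rfl, rfl⟩ := hB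
  set w := v + (v' - u') with hw
  have hvw : v ≤ w := by linarith
  set h : ℝ → X := fun x => if x ≤ v then f x else g (x - v + u') with hh
  have hmaps : MapsTo (fun x => x - v + u') (Icc v w) (Icc u' v') := fun x hx =>
    ⟨by linarith [hx.1], by linarith [hx.2]⟩
  have hf : EqOn h f (Icc u v) := fun x hx => if_pos hx.2
  have hg : EqOn h (fun x => g (x - v + u')) (Icc v w) := by
    intro x hx
    rcases hx.1.eq_or_lt with rfl | hlt
    · simp [hh, hfv, hgu]
    · exact if_neg hlt.not_ge
  have himg : (fun x => x - v + u') '' Icc v w = Icc u' v' := by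
    refine hmaps.image_subset.antisymm fun y hy => ⟨y - u' + v, ⟨?_, ?_⟩, by ring⟩
    · linarith [hy.1]
    · linarith [hy.2]
  have hcross : ∀ x ∈ Icc u v, ∀ y ∈ Icc v w, h x = h y → x = y := by
    intro x hx y hy hxy
    rw [hf hx, hg hy] at hxy
    have hxb : f x = b := hAB ⟨⟨x, hx, rfl⟩, ⟨_, hmaps hy, hxy.symm⟩⟩
    have h1 : x = v := hfi hx (right_mem_Icc.2 huv) (hxb.trans hfv.symm)
    have h2 : y - v + u' = u' := hgi (hmaps hy) (left_mem_Icc.2 huv')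
      (hxy.symm.trans (hxb.trans hgu.symm))
    linarith
  refine ⟨u, w, h, huv.trans hvw, ?_, ?_, hf (left_mem_Icc.2 huv), ?_, ?_⟩
  · rw [← Icc_union_Icc_eq_Icc huv hvw]
    refine (hfc.congr hf).union_of_isClosed (ContinuousOn.congr ?_ hg) isClosed_Icc isClosed_Icc
    exact hgc.comp (by fun_prop) hmaps
  · rw [← Icc_union_Icc_eq_Icc huv hvw]
    rintro x (hx | hx) y (hy | hy) hxy
    · exact hfi hx hy (by rwa [hf hx, hf hy] at hxy)
    · exact hcross x hx y hy hxy
    · exact (hcross y hy x hx hxy.symm).symm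
    · rw [hg hx, hg hy] at hxy
      have := hgi (hmaps hx) (hmaps hy) hxy
      linarith
  · rw [hg (right_mem_Icc.2 hvw), hw]
    ring_nf
  · rw [← Icc_union_Icc_eq_Icc huv hvw, image_union, hf.image_eq, hg.image_eq, ← himg, image_image]

theorem isArcBetween_segment {E : Type*} [NormedAddCommGroup E] [NormedSpace ℝ E] (a b : E) :
    IsArcBetween (segment ℝ a b) a b := by
  rcases eq_or_ne a b with rfl | hab
  · exact ⟨0, 0, fun _ => a, le_rfl, continuousOn_const, by simp, rfl, rfl, by simp⟩
  · exact ⟨0, 1, AffineMap.lineMap a b, zero_le_one, AffineMap.lineMap_continuous.continuousOn,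
      (AffineMap.lineMap_injective ℝ hab).injOn, by simp, by simp,
      (segment_eq_image_lineMap ℝ a b).symm⟩

theorem IsArcBetween.isSimpleRectifiableCurve {n : ℕ} {A : Set (EuclideanSpace ℝ (Fin n))}
    {a b : EuclideanSpace ℝ (Fin n)} (hA : IsArcBetween A a b) (hab : a ≠ b) (h : μH[1] A < ⊤) :
    IsSimpleRectifiableCurve A := by
  obtain ⟨u, v, γ, huv, hc, hi, rfl, rfl, rfl⟩ := hA
  have hlt : u < v := huv.lt_of_ne fun h => hab (h ▸ rfl)
  have himg : AffineMap.lineMap u v '' Icc (0 : ℝ) 1 = Icc u v := by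
    rw [← segment_eq_image_lineMap, segment_eq_Icc huv]
  refine ⟨⟨γ ∘ AffineMap.lineMap u v, ?_, ?_, ?_⟩, h⟩
  · exact hc.comp AffineMap.lineMap_continuous.continuousOn (himg ▸ mapsTo_image _ _)
  · exact hi.comp (AffineMap.lineMap_injective ℝ hlt.ne).injOn (himg ▸ mapsTo_image _ _)
  · rw [image_comp, himg]

theorem sausageLength_comm {n : ℕ} (Γ : Set (EuclideanSpace ℝ (Fin n))) (ε : ℝ)
    (p₁ p₂ : EuclideanSpace ℝ (Fin n)) : sausageLength Γ ε p₁ p₂ = sausageLength Γ ε p₂ p₁ := by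
  unfold sausageLength
  congr! 6 with L Γ'
  exact and_congr_right' and_left_comm

theorem IsSimpleRectifiableCurve.sausageLength_le {n : ℕ}
    {Γ A : Set (EuclideanSpace ℝ (Fin n))} (hA : IsSimpleRectifiableCurve A) {ε : ℝ}
    {p₁ p₂ : EuclideanSpace ℝ (Fin n)} (hsub : A ⊆ cthickening ε Γ) (hp₁ : p₁ ∈ A)
    (hp₂ : p₂ ∈ A) : sausageLength Γ ε p₁ p₂ ≤ μH[1] A :=
  sInf_le ⟨A, hA, hsub, hp₁, hp₂, rfl⟩

theorem IsArcBetween.sausageLength_le {n : ℕ} {Γ A : Set (EuclideanSpace ℝ (Fin n))} {ε : ℝ}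
    {p₁ p₂ : EuclideanSpace ℝ (Fin n)} (hA : IsArcBetween A p₁ p₂) (hne : p₁ ≠ p₂)
    (hsub : A ⊆ cthickening ε Γ) : sausageLength Γ ε p₁ p₂ ≤ μH[1] A := by
  rcases eq_top_or_lt_top (μH[1] A) with htop | htop
  · exact htop ▸ le_top
  have hA' := hA
  obtain ⟨u, v, γ, huv, -, -, rfl, rfl, rfl⟩ := hA'
  exact (hA.isSimpleRectifiableCurve hne htop).sausageLength_le hsub
    (mem_image_of_mem γ (left_mem_Icc.2 huv)) (mem_image_of_mem γ (right_mem_Icc.2 huv))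

/-- If `p'` is a point of `S` nearest to `p`, then it is the only point of `S` nearest to any
`x ≠ p` of the segment from `p` to `p'`. -/
theorem eq_of_mem_segment_of_dist_le {E : Type*} [NormedAddCommGroup E] [NormedSpace ℝ E]
    [StrictConvexSpace ℝ E] {p p' q x : E} (hx : x ∈ segment ℝ p p') (hxp : x ≠ p)
    (hp : dist p p' ≤ dist p q) (hq : dist x q ≤ dist x p') : q = p' := by
  have h1 := dist_add_dist_of_mem_segment hx
  have h2 := dist_triangle p x q
  have hD : dist p q = dist p p' := by linarith
  have hw : Wbtw ℝ p x q := dist_add_dist_eq_iff.1 (by linarith)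
  have hw' : Wbtw ℝ p x p' := mem_segment_iff_wbtw.1 hx
  obtain ⟨t, ht, rfl⟩ := hw
  obtain ⟨t', ht', heq⟩ := hw'
  have hn : t * dist p q = t' * dist p q := by
    have := congrArg (dist p) heq
    rw [dist_left_lineMap, dist_left_lineMap, Real.norm_of_nonneg ht.1,
      Real.norm_of_nonneg ht'.1, ← hD] at this
    exact this.symm
  have hpq : dist p q ≠ 0 := by
    intro h0
    rw [dist_eq_zero] at h0
    exact hxp (by simp [← h0])
  obtain rfl := mul_right_cancel₀ hpq hn
  have ht0 : t ≠ 0 := by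
    rintro rfl
    simp at hxp
  simp only [AffineMap.lineMap_apply_module'] at heq
  exact (sub_left_injective (smul_right_injective E ht0 (add_right_cancel heq))).symm

theorem sausageLength_le {n : ℕ} {Γ : Set (EuclideanSpace ℝ (Fin n))}
    (hΓ : IsSimpleRectifiableCurve Γ) {ε : ℝ} (hε : 0 < ε) {p₁ p₂ : EuclideanSpace ℝ (Fin n)}
    (hp₁ : p₁ ∈ cthickening ε Γ) (hp₂ : p₂ ∈ cthickening ε Γ) :
    sausageLength Γ ε p₁ p₂ ≤ μH[1] Γ + 2 * ENNReal.ofReal ε := by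
  obtain ⟨γ, hc, hi, hγ⟩ := hΓ.1
  have hcomp : IsCompact Γ := hγ ▸ isCompact_Icc.image_of_continuousOn hc
  have hne : Γ.Nonempty := hγ ▸ (nonempty_Icc.2 zero_le_one).image γ
  have hnear : ∀ p ∈ cthickening ε Γ, ∃ u ∈ Icc (0 : ℝ) 1, dist p (γ u) ≤ ε ∧
      ∀ q ∈ Γ, dist p (γ u) ≤ dist p q := by
    intro p hp
    obtain ⟨y, hy, hpy⟩ := hcomp.exists_infDist_eq_dist hne p
    obtain ⟨u, hu, rfl⟩ := hγ.symm ▸ hy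
    refine ⟨u, hu, hpy ▸ ?_, fun q hq => hpy ▸ infDist_le_dist_of_mem hq⟩
    exact ENNReal.toReal_le_of_le_ofReal hε.le hp
  have hmem : ∀ u ∈ Icc (0 : ℝ) 1, γ u ∈ Γ := fun u hu => hγ ▸ mem_image_of_mem γ hu
  have hseg : ∀ u ∈ Icc (0 : ℝ) 1, ∀ p q, dist p (γ u) ≤ ε → dist q (γ u) ≤ ε →
      segment ℝ p q ⊆ cthickening ε Γ := fun u hu p q hp hq =>
    ((convex_closedBall (γ u) ε).segment_subset hp hq).trans
      (closedBall_subset_cthickening (hmem u hu) ε)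
  rcases eq_or_ne p₁ p₂ with rfl | hp
  · obtain ⟨u, hu, hd, -⟩ := hnear p₁ hp₁
    rcases eq_or_ne p₁ (γ u) with rfl | hpu
    · exact (hΓ.sausageLength_le (self_subset_cthickening Γ) (hmem u hu)
        (hmem u hu)).trans le_self_add
    · have hcurve : IsSimpleRectifiableCurve (segment ℝ p₁ (γ u)) :=
        (isArcBetween_segment p₁ (γ u)).isSimpleRectifiableCurve hpu (by simp [edist_lt_top])
      refine (hcurve.sausageLength_le (hseg u hu _ _ hd (by simpa using hε.le))
        (left_mem_segment ℝ _ _) (left_mem_segment ℝ _ _)).trans ?_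
      rw [hausdorffMeasure_segment, edist_dist, two_mul]
      exact (ENNReal.ofReal_le_ofReal hd).trans (le_add_self.trans le_add_self)
  have key : ∀ p₁ p₂ : EuclideanSpace ℝ (Fin n), p₁ ≠ p₂ → ∀ u ∈ Icc (0 : ℝ) 1,
      ∀ v ∈ Icc (0 : ℝ) 1, u ≤ v → dist p₁ (γ u) ≤ ε → dist p₂ (γ v) ≤ ε →
      (∀ q ∈ Γ, dist p₁ (γ u) ≤ dist p₁ q) → (∀ q ∈ Γ, dist p₂ (γ v) ≤ dist p₂ q) →
      sausageLength Γ ε p₁ p₂ ≤ μH[1] Γ + 2 * ENNReal.ofReal ε := by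
    intro p₁ p₂ hp u hu v hv huv hd₁ hd₂ hmin₁ hmin₂
    rcases huv.eq_or_lt with rfl | huv
    · refine ((isArcBetween_segment p₁ p₂).sausageLength_le hp (hseg u hu _ _ hd₁ hd₂)).trans ?_
      rw [hausdorffMeasure_segment, two_mul, ← ENNReal.ofReal_add hε.le hε.le, edist_dist]
      exact (ENNReal.ofReal_le_ofReal ((dist_triangle_right p₁ p₂ _).trans
        (add_le_add hd₁ hd₂))).trans le_add_self
    have hne : γ u ≠ γ v := fun h => huv.ne (hi hu hv h)
    have hsubarc : γ '' Icc u v ⊆ Γ := hγ ▸ image_mono (Icc_subset_Icc hu.1 hv.2)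
    have harc : IsArcBetween (γ '' Icc u v) (γ u) (γ v) :=
      ⟨u, v, γ, huv.le, hc.mono (Icc_subset_Icc hu.1 hv.2), hi.mono (Icc_subset_Icc hu.1 hv.2),
        rfl, rfl, rfl⟩
    have hfoot : ∀ p p' x : EuclideanSpace ℝ (Fin n), (∀ q ∈ Γ, dist p p' ≤ dist p q) →
        x ∈ segment ℝ p p' → x ∈ Γ → x = p' := by
      intro p p' x hmin hx hxΓ
      have h1 := dist_add_dist_of_mem_segment hx
      have h2 := hmin x hxΓ
      exact dist_le_zero.1 (by linarith)
    have hdisj : ∀ x ∈ segment ℝ p₁ (γ u), x ∉ segment ℝ p₂ (γ v) := by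
      intro x hx₁ hx₂
      have h1 := dist_add_dist_of_mem_segment hx₁
      have h2 := dist_add_dist_of_mem_segment hx₂
      have h3 := dist_triangle p₁ x (γ v)
      have h4 := dist_triangle p₂ x (γ u)
      have h5 := hmin₁ _ (hmem v hv)
      have h6 := hmin₂ _ (hmem u hu)
      by_cases hx : x = p₁
      · by_cases hx' : x = p₂
        · exact hp (hx.symm.trans hx')
        · exact hne (eq_of_mem_segment_of_dist_le hx₂ hx' h6 (by linarith))
      · exact hne (eq_of_mem_segment_of_dist_le hx₁ hx h5 (by linarith)).symm
    have hfull : IsArcBetween (segment ℝ p₁ (γ u) ∪ γ '' Icc u v ∪ segment ℝ (γ v) p₂) p₁ p₂ := by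
      refine ((isArcBetween_segment p₁ (γ u)).union harc ?_).union
        (isArcBetween_segment (γ v) p₂) ?_
      · exact fun x hx => hfoot _ _ x hmin₁ hx.1 (hsubarc hx.2)
      · rw [segment_symm ℝ (γ v) p₂]
        rintro x ⟨hx | hx, hx'⟩
        · exact (hdisj x hx hx').elim
        · exact hfoot _ _ x hmin₂ hx' (hsubarc hx)
    refine (hfull.sausageLength_le hp ?_).trans ?_
    · refine union_subset (union_subset ?_ ?_) ?_
      · exact hseg u hu _ _ hd₁ (by simpa using hε.le)
      · exact hsubarc.trans (self_subset_cthickening Γ)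
      · exact hseg v hv _ _ (by simpa using hε.le) hd₂
    · refine (measure_union_le _ _).trans ((add_le_add (measure_union_le _ _) le_rfl).trans ?_)
      rw [hausdorffMeasure_segment, hausdorffMeasure_segment, edist_comm (γ v)]
      have e1 : edist p₁ (γ u) ≤ ENNReal.ofReal ε := edist_dist p₁ _ ▸ ENNReal.ofReal_le_ofReal hd₁
      have e2 : edist p₂ (γ v) ≤ ENNReal.ofReal ε := edist_dist p₂ _ ▸ ENNReal.ofReal_le_ofReal hd₂
      calc _ ≤ ENNReal.ofReal ε + μH[1] Γ + ENNReal.ofReal ε := by gcongr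
        _ = _ := by ring
  obtain ⟨u, hu, hd₁, hmin₁⟩ := hnear p₁ hp₁
  obtain ⟨v, hv, hd₂, hmin₂⟩ := hnear p₂ hp₂
  rcases le_total u v with huv | huv
  · exact key p₁ p₂ hp u hu v hv huv hd₁ hd₂ hmin₁ hmin₂
  · rw [sausageLength_comm]
    exact key p₂ p₁ hp.symm v hv u hu huv hd₂ hd₁ hmin₂ hmin₁

theorem sup_sausage_length_limit {n : ℕ}
    (Γ : Set (EuclideanSpace ℝ (Fin n))) (hΓ : IsSimpleRectifiableCurve Γ) :
    Tendsto
      (fun ε : ℝ =>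
        ⨆ p₁ ∈ cthickening ε Γ, ⨆ p₂ ∈ cthickening ε Γ, sausageLength Γ ε p₁ p₂)
      (nhdsWithin 0 (Ioi 0)) (nhds (μH[1] Γ)) := by
  obtain ⟨γ, hc, hi, hγ⟩ := hΓ.1
  refine tendsto_order.2 ⟨fun c hlt => ?_, fun c hlt => ?_⟩
  · obtain ⟨c', hc', hev⟩ :=
      exists_gt_eventually_le_hausdorffMeasure_of_isPreconnected hc hi (hγ.symm ▸ hlt)
    have hend : ∀ u ∈ Icc (0 : ℝ) 1, γ u ∈ Γ := fun u hu => hγ ▸ mem_image_of_mem γ hu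
    rw [hγ] at hev
    filter_upwards [hev] with ε hε
    refine hc'.trans_le (le_trans ?_ (le_iSup₂_of_le (γ 0)
      (self_subset_cthickening Γ (hend 0 (by simp)))
      (le_iSup₂_of_le (γ 1) (self_subset_cthickening Γ (hend 1 (by simp))) le_rfl)))
    refine le_sInf ?_
    rintro _ ⟨Γ', ⟨⟨γ', hcγ', -, rfl⟩, -⟩, hsub, h0, h1, rfl⟩
    exact hε _ (isCompact_Icc.image_of_continuousOn hcγ').isClosed
      (isPreconnected_Icc.image γ' hcγ') hsub h0 h1
  · have hlim : Tendsto (fun ε : ℝ => μH[1] Γ + 2 * ENNReal.ofReal ε)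
        (nhdsWithin 0 (Ioi 0)) (nhds (μH[1] Γ)) := by
      have h : Continuous fun ε : ℝ => μH[1] Γ + 2 * ENNReal.ofReal ε :=
        continuous_const.add
          ((ENNReal.continuous_const_mul (by simp)).comp ENNReal.continuous_ofReal)
      simpa using (h.tendsto 0).mono_left nhdsWithin_le_nhds
    filter_upwards [hlim.eventually_lt_const hlt, self_mem_nhdsWithin] with ε hε hpos
    refine lt_of_le_of_lt ?_ hε
    exact iSup₂_le fun p₁ hp₁ => iSup₂_le fun p₂ hp₂ => sausageLength_le hΓ hpos hp₁ hp₂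
end

section
/- Let Γ = γ([0,1]) ⊆ ℝⁿ be a simple rectifiable curve (γ continuous, possibly not injective, but Γ is simple). For a dissection a of [0,1] let S(a) = {γ(aᵢ)} and let LMST(a) be the longest path inside a Euclidean minimum spanning tree of S(a). If (a_n) is a sequence of dissections with mesh(a_n) → 0, then H¹(LMST(a_n)) → H¹(Γ). -/
open Set Metric MeasureTheory ENNReal Filter Classical

/-- Length of a polygonal chain through a list of points. -/
noncomputable def polyLength {E : Type*} [MetricSpace E] : List E → ℝ
  | [] => 0
  | [_] => 0
  | x :: y :: l => dist x y + polyLength (y :: l)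

/-- The point set (union of segments) of a polygonal chain through a list of points. -/
def polySet {n : ℕ} : List (EuclideanSpace ℝ (Fin n)) → Set (EuclideanSpace ℝ (Fin n))
  | [] => ∅
  | [x] => {x}
  | x :: y :: l => segment ℝ x y ∪ polySet (y :: l)

/-- Total Euclidean edge length of a graph on points of `ℝⁿ`. -/
noncomputable def graphWeight {V : Type*} [Fintype V] {n : ℕ}
    (pos : V → EuclideanSpace ℝ (Fin n)) (T : SimpleGraph V) : ℝ :=
  (1 / 2) * ∑ u : V, ∑ v : V, if T.Adj u v then dist (pos u) (pos v) else 0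

def IsSpanningTree {V : Type*} (T : SimpleGraph V) : Prop :=
  T.Connected ∧ T.IsAcyclic


theorem hausdorffMeasure_one_singleton {E : Type*} [MetricSpace E] [MeasurableSpace E]
    [BorelSpace E] (x : E) : μH[1] ({x} : Set E) = 0 :=
  haveI := Measure.nullSingletonClass_hausdorff E one_pos
  measure_singleton x

/-- A preconnected set has one-dimensional Hausdorff measure at least the distance between any two
of its points. -/
theorem IsPreconnected.edist_le_hausdorffMeasure {E : Type*} [MetricSpace E] [MeasurableSpace E]
    [BorelSpace E] {s : Set E} (hs : IsPreconnected s) {x y : E} (hx : x ∈ s) (hy : y ∈ s) :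
    edist x y ≤ μH[1] s := by
  have hl : LipschitzWith 1 (fun z => dist z x) := LipschitzWith.dist_left x
  have himg : Icc 0 (dist y x) ⊆ (fun z => dist z x) '' s := by
    have := (hs.image _ hl.continuous.continuousOn).ordConnected.out
      (mem_image_of_mem _ hx) (mem_image_of_mem _ hy)
    simpa using this
  calc edist x y = volume (Icc 0 (dist y x)) := by
        rw [Real.volume_Icc, sub_zero, edist_comm, edist_dist]
    _ ≤ volume ((fun z => dist z x) '' s) := measure_mono himg
    _ = μH[1] ((fun z => dist z x) '' s) := by rw [hausdorffMeasure_real]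
    _ ≤ μH[1] s := by simpa using hl.hausdorffMeasure_image_le zero_le_one s

/-- The variation of an injective curve is at most the Hausdorff measure of its image. -/
theorem eVariationOn_le_hausdorffMeasure_image {E : Type*} [MetricSpace E] [MeasurableSpace E]
    [BorelSpace E] {f : ℝ → E} {s : Set ℝ} (hs : s.OrdConnected) (hc : ContinuousOn f s)
    (hi : InjOn f s) : eVariationOn f s ≤ μH[1] (f '' s) := by
  refine iSup_le ?_
  rintro ⟨n, u, hu, us⟩
  have hsub (i : ℕ) : Icc (u i) (u (i + 1)) ⊆ s := hs.out (us i) (us (i + 1))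
  have hle (i : ℕ) : u i ≤ u (i + 1) := hu i.le_succ
  have hIco (i : ℕ) : f '' Ico (u i) (u (i + 1)) = f '' Icc (u i) (u (i + 1)) \ {f (u (i + 1))} := by
    rw [← Icc_sdiff_right, (hi.mono (hsub i)).image_sdiff_subset (by simpa using hle i),
      image_singleton]
  have hIcc (i : ℕ) : MeasurableSet (f '' Icc (u i) (u (i + 1))) :=
    (isCompact_Icc.image_of_continuousOn (hc.mono (hsub i))).measurableSet
  calc ∑ i ∈ Finset.range n, edist (f (u (i + 1))) (f (u i))
      ≤ ∑ i ∈ Finset.range n, μH[1] (f '' Ico (u i) (u (i + 1))) := by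
        refine Finset.sum_le_sum fun i _ => ?_
        rw [hIco, measure_sdiff_null (hausdorffMeasure_one_singleton _)]
        exact (isPreconnected_Icc.image f (hc.mono (hsub i))).edist_le_hausdorffMeasure
          (mem_image_of_mem f (right_mem_Icc.2 (hle i)))
          (mem_image_of_mem f (left_mem_Icc.2 (hle i)))
    _ = μH[1] (⋃ i ∈ Finset.range n, f '' Ico (u i) (u (i + 1))) := by
        refine (measure_biUnion_finset ?_ ?_).symm
        · intro i _ j _ hij
          exact (hu.pairwise_disjoint_on_Ico_succ hij).image hi
            (Ico_subset_Icc_self.trans (hsub i)) (Ico_subset_Icc_self.trans (hsub j))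
        · intro i _
          rw [hIco]
          exact (hIcc i).diff (measurableSet_singleton _)
    _ ≤ μH[1] (f '' s) := by
        refine measure_mono (iUnion₂_subset fun i _ => image_mono ?_)
        exact Ico_subset_Icc_self.trans (hsub i)

/-- The Hausdorff measure of the image of a curve is at most its variation. -/
theorem hausdorffMeasure_image_le_eVariationOn {E : Type*} [MetricSpace E] [MeasurableSpace E]
    [BorelSpace E] (f : ℝ → E) {a b : ℝ} (hab : a ≤ b) :
    μH[1] (f '' Icc a b) ≤ eVariationOn f (Icc a b) := by
  rcases eq_or_ne (eVariationOn f (Icc a b)) ⊤ with htop | htop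
  · simp [htop]
  have hloc : LocallyBoundedVariationOn f (Icc a b) :=
    BoundedVariationOn.locallyBoundedVariationOn htop
  have ha : a ∈ Icc a b := left_mem_Icc.2 hab
  set g := naturalParameterization f (Icc a b) a with hg
  set V := variationOnFromTo f (Icc a b) a with hV
  have hlip : LipschitzOnWith 1 g (V '' Icc a b) := by
    have hspeed := has_unit_speed_naturalParameterization f hloc ha
    have key : ∀ x ∈ V '' Icc a b, ∀ y ∈ V '' Icc a b, x ≤ y → edist (g x) (g y) ≤ edist x y := by
      intro x hx y hy hxy
      calc edist (g x) (g y) ≤ eVariationOn g (V '' Icc a b ∩ Icc x y) :=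
            eVariationOn.edist_le g ⟨hx, left_mem_Icc.2 hxy⟩ ⟨hy, right_mem_Icc.2 hxy⟩
        _ = ENNReal.ofReal (1 * (y - x)) := hspeed hx hy
        _ = edist x y := by
            rw [one_mul, edist_comm, edist_dist, Real.dist_eq, abs_of_nonneg (sub_nonneg.2 hxy)]
    intro x hx y hy
    rw [ENNReal.coe_one, one_mul]
    rcases le_total x y with h | h
    · exact key x hx y hy h
    · rw [edist_comm, edist_comm x]
      exact key y hy x hx h
  have himg : f '' Icc a b ⊆ g '' (V '' Icc a b) := by
    rintro _ ⟨t, ht, rfl⟩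
    exact ⟨V t, mem_image_of_mem V ht,
      edist_eq_zero.1 (edist_naturalParameterization_eq_zero hloc ha ht)⟩
  have hVimg : V '' Icc a b ⊆ Icc 0 (eVariationOn f (Icc a b)).toReal := by
    rintro _ ⟨t, ht, rfl⟩
    rw [hV, variationOnFromTo.eq_of_le _ _ ht.1]
    exact ⟨ENNReal.toReal_nonneg,
      ENNReal.toReal_mono htop (eVariationOn.mono f inter_subset_left)⟩
  calc μH[1] (f '' Icc a b) ≤ μH[1] (g '' (V '' Icc a b)) := measure_mono himg
    _ ≤ μH[1] (V '' Icc a b) := by simpa using hlip.hausdorffMeasure_image_le zero_le_one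
    _ ≤ μH[1] (Icc 0 (eVariationOn f (Icc a b)).toReal) := measure_mono hVimg
    _ = eVariationOn f (Icc a b) := by
        rw [hausdorffMeasure_real, Real.volume_Icc, sub_zero, ENNReal.ofReal_toReal htop]

/-- Reparametrising a continuous curve with a small (possibly discontinuous) error does not decrease
its variation by much. -/
theorem exists_pos_forall_lt_eVariationOn_comp {E : Type*} [PseudoEMetricSpace E] {f : ℝ → E}
    {s : Set ℝ} (hc : ContinuousOn f s) {v : ℝ≥0∞} (hv : v < eVariationOn f s) :
    ∃ η > 0, ∀ φ : ℝ → ℝ, (∀ t ∈ s, φ t ∈ s ∧ |φ t - t| ≤ η) → v < eVariationOn (f ∘ φ) s := by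
  by_contra! hcon
  choose φ hφ hφv using fun k : ℕ => hcon (1 / ((k : ℝ) + 1)) (by positivity)
  have hlim : ∀ t ∈ s, Tendsto (fun k => (f ∘ φ k) t) atTop (nhds (f t)) := by
    intro t ht
    refine (hc t ht).tendsto.comp (tendsto_nhdsWithin_iff.2 ⟨?_, .of_forall fun k => (hφ k t ht).1⟩)
    refine tendsto_iff_dist_tendsto_zero.2 ?_
    exact squeeze_zero (fun _ => dist_nonneg) (fun k => (hφ k t ht).2)
      tendsto_one_div_add_atTop_nhds_zero_nat
  obtain ⟨k, hk⟩ := (eVariationOn.lowerSemicontinuous_aux hlim hv).exists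
  exact absurd hk (hφv k).not_gt

/-- A finite real sequence with small steps which starts near `0` and ends near `1` can be read
monotonically so as to follow the identity of `[0, 1]`. -/
theorem exists_monotone_abs_sub_le {s : ℕ → ℝ} {M : ℕ} {η : ℝ} (hstart : s 0 ≤ η)
    (hnonneg : 0 ≤ s 0) (hend : 1 - η ≤ s M) (hstep : ∀ i < M, |s (i + 1) - s i| ≤ η) :
    ∃ j : ℝ → ℕ, Monotone j ∧ (∀ t, j t ≤ M) ∧ ∀ t ∈ Icc (0 : ℝ) 1, |s (j t) - t| ≤ η := by
  have hex (t : ℝ) : ∃ i, M ≤ i ∨ t ≤ s i := ⟨M, .inl le_rfl⟩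
  refine ⟨fun t => Nat.find (hex t), fun t t' htt' => ?_, fun t => Nat.find_min' _ (.inl le_rfl),
    fun t ht => ?_⟩
  · exact Nat.find_mono fun i hi => hi.imp_right htt'.trans
  · have hspec := Nat.find_spec (hex t)
    have hmin := fun i => Nat.find_min (hex t) (m := i)
    change |s (Nat.find (hex t)) - t| ≤ η
    generalize Nat.find (hex t) = i at hspec hmin ⊢
    rw [abs_le]
    obtain ⟨ht0, ht1⟩ := ht
    cases i with
    | zero =>
      rcases hspec with h | h
      · obtain rfl : M = 0 := by omega
        constructor <;> linarith
      · constructor <;> linarith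
    | succ i =>
      have hi := hmin i i.lt_succ_self
      push Not at hi
      have hst := abs_le.1 (hstep i hi.1)
      refine ⟨?_, by linarith⟩
      rcases hspec with h | h
      · obtain rfl : M = i + 1 := by omega
        linarith
      · linarith [abs_nonneg (s (i + 1) - s i), hstep i hi.1]

/-- Reading finitely many terms of a sequence in monotone order gives a function of variation at
most the length of the sequence. -/
theorem eVariationOn_comp_monotone_le {E : Type*} [PseudoEMetricSpace E] (x : ℕ → E) {M : ℕ}
    {j : ℝ → ℕ} (hj : Monotone j) (hjM : ∀ t, j t ≤ M) (s : Set ℝ) :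
    eVariationOn (x ∘ j) s ≤ ∑ i ∈ Finset.range M, edist (x i) (x (i + 1)) := by
  refine iSup_le ?_
  rintro ⟨n, u, hu, us⟩
  have hju : Monotone (j ∘ u) := hj.comp hu
  calc ∑ i ∈ Finset.range n, edist ((x ∘ j) (u (i + 1))) ((x ∘ j) (u i))
      ≤ ∑ i ∈ Finset.range n, ∑ l ∈ Finset.Ico (j (u i)) (j (u (i + 1))),
          edist (x l) (x (l + 1)) := by
        refine Finset.sum_le_sum fun i _ => ?_
        rw [edist_comm]
        exact edist_le_Ico_sum_edist x (hju i.le_succ)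
    _ = ∑ l ∈ Finset.Ico (j (u 0)) (j (u n)), edist (x l) (x (l + 1)) := by
        induction n with
        | zero => simp
        | succ n ih =>
          rw [Finset.sum_range_succ, ih]
          exact Finset.sum_Ico_consecutive _ (hju n.zero_le) (hju n.le_succ)
    _ ≤ _ := by
        refine Finset.sum_le_sum_of_subset fun l hl => ?_
        have := hjM (u n)
        simp only [Finset.mem_Ico, Finset.mem_range] at hl ⊢
        omega

/-- An injective continuous curve on `[0, 1]` has a uniformly continuous inverse. -/
theorem exists_pos_forall_dist_lt_imp_abs_sub_lt {E : Type*} [MetricSpace E] {f : ℝ → E}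
    (hc : ContinuousOn f (Icc 0 1)) (hi : InjOn f (Icc 0 1)) {η : ℝ} (hη : 0 < η) :
    ∃ δ > 0, ∀ s ∈ Icc (0 : ℝ) 1, ∀ t ∈ Icc (0 : ℝ) 1, dist (f s) (f t) < δ → |s - t| < η := by
  let K : Set (ℝ × ℝ) := (Icc 0 1 ×ˢ Icc 0 1) ∩ {p | η ≤ |p.1 - p.2|}
  have hK : IsCompact K := (isCompact_Icc.prod isCompact_Icc).inter_right
    (isClosed_le continuous_const (by fun_prop))
  have hd : ContinuousOn (fun p : ℝ × ℝ => dist (f p.1) (f p.2)) K :=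
    continuous_dist.comp_continuousOn
      ((hc.comp continuousOn_fst fun p (hp : p ∈ K) => hp.1.1).prodMk
        (hc.comp continuousOn_snd fun p (hp : p ∈ K) => hp.1.2))
  rcases K.eq_empty_or_nonempty with hemp | hne
  · refine ⟨1, one_pos, fun s hs t ht _ => ?_⟩
    by_contra! h
    exact (hemp.subset (show (s, t) ∈ K from ⟨⟨hs, ht⟩, h⟩)).elim
  · obtain ⟨p, hp, hmin⟩ := hK.exists_isMinOn hne hd
    refine ⟨dist (f p.1) (f p.2), dist_pos.2 fun h => ?_, fun s hs t ht hst => ?_⟩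
    · have h12 := hi hp.1.1 hp.1.2 h
      have : η ≤ |p.1 - p.2| := hp.2
      rw [h12, sub_self, abs_zero] at this
      exact hη.not_ge this
    · by_contra! h
      exact hst.not_ge (hmin (show (s, t) ∈ K from ⟨⟨hs, ht⟩, h⟩))

theorem polyLength_map_support_cons {V E : Type*} [MetricSpace E] {G : SimpleGraph V} (pos : V → E)
    {u v w : V} (h : G.Adj u v) (p : G.Walk v w) :
    polyLength ((SimpleGraph.Walk.cons h p).support.map pos) =
      dist (pos u) (pos v) + polyLength (p.support.map pos) := by
  rw [SimpleGraph.Walk.support_cons, ← p.cons_tail_support]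
  rfl

theorem polySet_map_support_cons {V : Type*} {n : ℕ} {G : SimpleGraph V}
    (pos : V → EuclideanSpace ℝ (Fin n)) {u v w : V} (h : G.Adj u v) (p : G.Walk v w) :
    polySet ((SimpleGraph.Walk.cons h p).support.map pos) =
      segment ℝ (pos u) (pos v) ∪ polySet (p.support.map pos) := by
  rw [SimpleGraph.Walk.support_cons, ← p.cons_tail_support]
  rfl

theorem polyLength_map_support {V E : Type*} [MetricSpace E] {G : SimpleGraph V} (pos : V → E)
    {u v : V} (w : G.Walk u v) :
    polyLength (w.support.map pos) =
      ∑ i ∈ Finset.range w.length, dist (pos (w.getVert i)) (pos (w.getVert (i + 1))) := by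
  induction w with
  | nil => simp [polyLength]
  | cons h p ih =>
    rw [polyLength_map_support_cons, ih, SimpleGraph.Walk.length_cons, Finset.sum_range_succ',
      add_comm]
    simp

theorem isClosed_polySet {n : ℕ} (l : List (EuclideanSpace ℝ (Fin n))) : IsClosed (polySet l) := by
  induction l with
  | nil => exact isClosed_empty
  | cons x l ih =>
    cases l with
    | nil => exact isClosed_singleton
    | cons y l =>
      refine IsClosed.union ?_ ih
      rw [segment_eq_image_lineMap]
      exact (isCompact_Icc.image AffineMap.lineMap_continuous).isClosed

/-- A set which meets every edge of a walk in a null set meets the polygon of the walk in a null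
set. -/
theorem hausdorffMeasure_inter_polySet_eq_zero {V : Type*} {n : ℕ} {G : SimpleGraph V}
    (pos : V → EuclideanSpace ℝ (Fin n)) {u v : V} (w : G.Walk u v)
    {A : Set (EuclideanSpace ℝ (Fin n))}
    (hA : ∀ x ∈ w.support, ∀ y ∈ w.support, G.Adj x y →
      μH[1] (A ∩ segment ℝ (pos x) (pos y)) = 0) :
    μH[1] (A ∩ polySet (w.support.map pos)) = 0 := by
  induction w with
  | nil => exact measure_mono_null inter_subset_right (hausdorffMeasure_one_singleton _)
  | cons h p ih =>
    rw [polySet_map_support_cons, inter_union_distrib_left]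
    refine measure_union_null (hA _ (by simp) _ (by simp) h) (ih fun x hx y hy => ?_)
    exact hA x (by simp [hx]) y (by simp [hy])

/-- If distinct edges overlap in null sets, the Hausdorff measure of the polygon of a path is its
length. -/
theorem hausdorffMeasure_polySet_eq {V : Type*} {n : ℕ} {G : SimpleGraph V}
    (pos : V → EuclideanSpace ℝ (Fin n))
    (hG : ∀ u v x y, G.Adj u v → G.Adj x y → u ≠ x → u ≠ y →
      μH[1] (segment ℝ (pos u) (pos v) ∩ segment ℝ (pos x) (pos y)) = 0)
    {u v : V} (w : G.Walk u v) (hw : w.IsPath) :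
    μH[1] (polySet (w.support.map pos)) = ENNReal.ofReal (polyLength (w.support.map pos)) := by
  induction w with
  | nil => simp [polySet, polyLength, hausdorffMeasure_one_singleton]
  | @cons a b c h p ih =>
    rw [SimpleGraph.Walk.cons_isPath_iff] at hw
    rw [polySet_map_support_cons, polyLength_map_support_cons,
      measure_union₀ (isClosed_polySet _).measurableSet.nullMeasurableSet, ih hw.1,
      hausdorffMeasure_segment, edist_dist, ENNReal.ofReal_add dist_nonneg]
    · rw [polyLength_map_support]
      exact Finset.sum_nonneg fun _ _ => dist_nonneg
    · refine hausdorffMeasure_inter_polySet_eq_zero pos p fun x hx y hy hxy => hG _ _ _ _ h hxy ?_ ?_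
      · rintro rfl
        exact hw.2 hx
      · rintro rfl
        exact hw.2 hy

/-- Two nondegenerate segments which share two distinct points either have the same endpoints, or
one has an endpoint in the relative interior of the other. -/
theorem segment_overlap_cases {E : Type*} [AddCommGroup E] [Module ℝ E] {u v a b p q : E}
    (hpq : p ≠ q) (hp : p ∈ segment ℝ u v) (hq : q ∈ segment ℝ u v) (hp' : p ∈ segment ℝ a b)
    (hq' : q ∈ segment ℝ a b) :
    a ∈ openSegment ℝ u v ∨ b ∈ openSegment ℝ u v ∨ u ∈ openSegment ℝ a b ∨ u = a ∨ u = b := by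
  rw [segment_eq_image_lineMap] at hp hq hp' hq'
  obtain ⟨s, hs, rfl⟩ := hp
  obtain ⟨t, ht, rfl⟩ := hq
  obtain ⟨s', hs', hps⟩ := hp'
  obtain ⟨t', ht', hqt⟩ := hq'
  rw [openSegment_eq_image_lineMap, openSegment_eq_image_lineMap]
  have hst' : s' - t' ≠ 0 := by
    intro h
    rw [sub_eq_zero.1 h] at hps
    exact hpq (hps.symm.trans hqt)
  have hst : s - t ≠ 0 := by
    intro h
    exact hpq (by rw [sub_eq_zero.1 h])
  have hdir : (s - t) • (v - u) = (s' - t') • (b - a) := by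
    have : AffineMap.lineMap u v s - AffineMap.lineMap u v t =
      (AffineMap.lineMap a b s' - AffineMap.lineMap a b t' : E) := by rw [hps, hqt]
    simp only [AffineMap.lineMap_apply_module'] at this
    linear_combination (norm := module) this
  set c := (s - t) / (s' - t') with hc
  have hba : b - a = c • (v - u) := by
    rw [hc, div_eq_inv_mul, mul_smul, hdir, smul_smul, inv_mul_cancel₀ hst', one_smul]
  set α := s - s' * c with hα
  have ha : a = AffineMap.lineMap u v α := by
    simp only [AffineMap.lineMap_apply_module', hba, smul_smul] at hps ⊢
    rw [hα]
    linear_combination (norm := module) hps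
  have hb : b = AffineMap.lineMap u v (α + c) := by
    simp only [AffineMap.lineMap_apply_module'] at ha ⊢
    linear_combination (norm := module) hba + ha
  have hc0 : c ≠ 0 := div_ne_zero hst hst'
  have hsα : s = α + s' * c := by rw [hα]; ring
  have htα : t = α + t' * c := by
    have : c * (s' - t') = s - t := div_mul_cancel₀ _ hst'
    linarith
  obtain ⟨hs0, hs1⟩ := hs
  obtain ⟨ht0, ht1⟩ := ht
  obtain ⟨hs0', hs1'⟩ := hs'
  obtain ⟨ht0', ht1'⟩ := ht'
  by_cases h1 : α ∈ Ioo 0 1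
  · exact .inl ⟨α, h1, ha.symm⟩
  by_cases h2 : α + c ∈ Ioo 0 1
  · exact .inr (.inl ⟨α + c, h2, hb.symm⟩)
  by_cases h3 : α = 0
  · right; right; right; left
    rw [ha, h3, AffineMap.lineMap_apply_zero]
  by_cases h4 : α + c = 0
  · right; right; right; right
    rw [hb, h4, AffineMap.lineMap_apply_zero]
  right; right; left
  refine ⟨-α / c, ?_, ?_⟩
  · rcases hc0.lt_or_gt with hneg | hpos
    · have h5 : 1 ≤ α := by
        by_contra! h
        refine h1 ⟨lt_of_le_of_ne ?_ (Ne.symm h3), h⟩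
        nlinarith
      have h6 : α + c < 0 := by
        refine lt_of_le_of_ne ?_ h4
        by_contra! h
        have h7 : 1 ≤ α + c := not_lt.1 fun h' => h2 ⟨h, h'⟩
        refine hst ?_
        have : s = 1 := by nlinarith
        have : t = 1 := by nlinarith
        linarith
      exact ⟨div_pos_of_neg_of_neg (by linarith) hneg, (div_lt_one_of_neg hneg).2 (by linarith)⟩
    · have h5 : 1 ≤ α + c := by
        by_contra! h
        refine h2 ⟨lt_of_le_of_ne ?_ (Ne.symm h4), h⟩
        nlinarith
      have h6 : α < 0 := by
        refine lt_of_le_of_ne ?_ h3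
        by_contra! h
        have h7 : 1 ≤ α := not_lt.1 fun h' => h1 ⟨h, h'⟩
        refine hst ?_
        have : s = 1 := by nlinarith
        have : t = 1 := by nlinarith
        linarith
      exact ⟨div_pos (by linarith) hpos, (div_lt_one hpos).2 (by linarith)⟩
  · rw [AffineMap.lineMap_apply_module', hba, smul_smul, div_mul_cancel₀ _ hc0, ha,
      AffineMap.lineMap_apply_module']
    module

theorem graphWeight_eq {V : Type*} [Fintype V] {n : ℕ} (pos : V → EuclideanSpace ℝ (Fin n))
    (G : SimpleGraph V) [DecidableRel G.Adj] : graphWeight pos G =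
      (1 / 2) * ∑ u, ∑ v, if G.Adj u v then dist (pos u) (pos v) else 0 := by
  unfold graphWeight
  congr!

theorem graphWeight_mono {V : Type*} [Fintype V] {n : ℕ} (pos : V → EuclideanSpace ℝ (Fin n))
    {G H : SimpleGraph V} (h : G ≤ H) : graphWeight pos G ≤ graphWeight pos H := by
  unfold graphWeight
  refine mul_le_mul_of_nonneg_left (Finset.sum_le_sum fun u _ => Finset.sum_le_sum fun v _ => ?_)
    (by norm_num)
  by_cases hG : G.Adj u v
  · simp [hG, h hG]
  · simp only [hG, if_false]
    split_ifs <;> simp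

theorem graphWeight_bot {V : Type*} [Fintype V] {n : ℕ} (pos : V → EuclideanSpace ℝ (Fin n)) :
    graphWeight pos ⊥ = 0 := by
  simp [graphWeight]

theorem graphWeight_sup_edge_le {V : Type*} [Fintype V] {n : ℕ}
    (pos : V → EuclideanSpace ℝ (Fin n)) (G : SimpleGraph V) (x y : V) :
    graphWeight pos (G ⊔ SimpleGraph.edge x y) ≤ graphWeight pos G + dist (pos x) (pos y) := by
  have key : ∀ u v : V, (if (G ⊔ SimpleGraph.edge x y).Adj u v then dist (pos u) (pos v) else 0) ≤
      (if G.Adj u v then dist (pos u) (pos v) else 0) +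
      ((if u = x then if v = y then dist (pos x) (pos y) else 0 else 0) +
      (if u = y then if v = x then dist (pos x) (pos y) else 0 else 0)) := by
    intro u v
    have h1 : 0 ≤ (if G.Adj u v then dist (pos u) (pos v) else 0) := by split_ifs <;> simp
    have h2 : 0 ≤ (if u = x then if v = y then dist (pos x) (pos y) else 0 else 0) := by
      split_ifs <;> simp
    have h3 : 0 ≤ (if u = y then if v = x then dist (pos x) (pos y) else 0 else 0) := by
      split_ifs <;> simp
    by_cases hadj : (G ⊔ SimpleGraph.edge x y).Adj u v
    · rw [if_pos hadj]
      rw [SimpleGraph.sup_adj, SimpleGraph.edge_adj] at hadj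
      rcases hadj with h | ⟨⟨rfl, rfl⟩ | ⟨rfl, rfl⟩, -⟩
      · rw [if_pos h] at h1 ⊢
        linarith
      · rw [if_pos rfl, if_pos rfl] at h2 ⊢
        linarith
      · rw [if_pos rfl, if_pos rfl] at h3
        rw [if_pos (c := u = u) rfl, if_pos (c := v = v) rfl]
        linarith [dist_comm (pos u) (pos v)]
    · rw [if_neg hadj]
      linarith
  have hsum := Finset.sum_le_sum fun u (_ : u ∈ Finset.univ) =>
    Finset.sum_le_sum fun v (_ : v ∈ Finset.univ) => key u v
  rw [graphWeight_eq, graphWeight_eq]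
  simp only [Finset.sum_add_distrib, Finset.sum_ite_eq', Finset.mem_univ, if_true,
    Finset.sum_ite_irrel, Finset.sum_const_zero] at hsum
  linarith

theorem graphWeight_deleteEdge_add_dist {V : Type*} [Fintype V] {n : ℕ}
    (pos : V → EuclideanSpace ℝ (Fin n)) {G : SimpleGraph V} {x y : V} (h : G.Adj x y) :
    graphWeight pos (G \ SimpleGraph.edge x y) + dist (pos x) (pos y) ≤ graphWeight pos G := by
  have key : ∀ u v : V, (if (G \ SimpleGraph.edge x y).Adj u v then dist (pos u) (pos v) else 0) +
      ((if u = x then if v = y then dist (pos x) (pos y) else 0 else 0) +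
      (if u = y then if v = x then dist (pos x) (pos y) else 0 else 0)) ≤
      (if G.Adj u v then dist (pos u) (pos v) else 0) := by
    intro u v
    have hne := h.ne
    by_cases h1 : u = x ∧ v = y
    · obtain ⟨rfl, rfl⟩ := h1
      simp [SimpleGraph.sdiff_adj, SimpleGraph.edge_adj, h, hne]
    by_cases h2 : u = y ∧ v = x
    · obtain ⟨rfl, rfl⟩ := h2
      simp [SimpleGraph.sdiff_adj, SimpleGraph.edge_adj, h.symm, hne, hne.symm, dist_comm]
    have h3 : (if u = x then if v = y then dist (pos x) (pos y) else 0 else 0) = 0 := by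
      grind
    have h4 : (if u = y then if v = x then dist (pos x) (pos y) else 0 else 0) = 0 := by
      grind
    rw [h3, h4, add_zero, add_zero]
    by_cases hG : G.Adj u v
    · rw [if_pos hG]
      split_ifs <;> simp
    · rw [if_neg hG, if_neg fun hadj => hG hadj.1]
  have hsum := Finset.sum_le_sum fun u (_ : u ∈ Finset.univ) =>
    Finset.sum_le_sum fun v (_ : v ∈ Finset.univ) => key u v
  rw [graphWeight_eq, graphWeight_eq]
  simp only [Finset.sum_add_distrib, Finset.sum_ite_eq', Finset.mem_univ, if_true,
    Finset.sum_ite_irrel, Finset.sum_const_zero] at hsum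
  linarith

/-- The length of a path in a graph is at most the weight of the graph. -/
theorem polyLength_map_support_le_graphWeight {V : Type*} [Fintype V] {n : ℕ}
    (pos : V → EuclideanSpace ℝ (Fin n)) {G : SimpleGraph V} {u v : V} (w : G.Walk u v)
    (hw : w.IsPath) : polyLength (w.support.map pos) ≤ graphWeight pos G := by
  set f : V → V → ℝ := fun x y => if G.Adj x y then dist (pos x) (pos y) else 0 with hf
  have hf0 (x y : V) : 0 ≤ f x y := by
    simp only [hf]
    split_ifs <;> simp
  have key : 2 * polyLength (w.support.map pos) ≤
      ∑ x ∈ w.support.toFinset, ∑ y ∈ w.support.toFinset, f x y := by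
    induction w with
    | nil => simp [polyLength, hf0]
    | @cons a b c h p ih =>
      rw [SimpleGraph.Walk.cons_isPath_iff] at hw
      have ha : a ∉ p.support.toFinset := by simpa using hw.2
      have hb : b ∈ p.support.toFinset := by simp
      have hab : f a b = dist (pos a) (pos b) := if_pos h
      have hba : f b a = dist (pos a) (pos b) := by rw [dist_comm]; exact if_pos h.symm
      have h1 := Finset.single_le_sum (f := fun y => f a y) (fun y _ => hf0 a y) hb
      have h2 := Finset.single_le_sum (f := fun y => f y a) (fun y _ => hf0 y a) hb
      rw [polyLength_map_support_cons, SimpleGraph.Walk.support_cons, List.toFinset_cons,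
        Finset.sum_insert ha, Finset.sum_insert ha]
      simp only [Finset.sum_insert ha, Finset.sum_add_distrib]
      linarith [ih hw.1, hf0 a a]
  have hle : ∑ x ∈ w.support.toFinset, ∑ y ∈ w.support.toFinset, f x y ≤ ∑ x, ∑ y, f x y :=
    (Finset.sum_le_sum fun x _ => Finset.sum_le_sum_of_subset_of_nonneg (Finset.subset_univ _)
      fun y _ _ => hf0 x y).trans (Finset.sum_le_sum_of_subset_of_nonneg (Finset.subset_univ _)
        fun x _ _ => Finset.sum_nonneg fun y _ => hf0 x y)
  have : graphWeight pos G = 1 / 2 * ∑ x, ∑ y, f x y := rfl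
  linarith

/-- A minimum spanning tree has minimal weight among all connected graphs. -/
theorem graphWeight_le_of_connected {V : Type*} [Fintype V] {n : ℕ}
    {pos : V → EuclideanSpace ℝ (Fin n)} {T : SimpleGraph V}
    (hmin : ∀ T', IsSpanningTree T' → graphWeight pos T ≤ graphWeight pos T')
    {G : SimpleGraph V} (hG : G.Connected) : graphWeight pos T ≤ graphWeight pos G := by
  obtain ⟨T', hle, hT'⟩ := hG.exists_isTree_le
  exact (hmin T' ⟨hT'.1, hT'.2⟩).trans (graphWeight_mono pos hle)

/-- In a connected graph, every vertex stays connected to an endpoint of a deleted edge. -/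
theorem SimpleGraph.Connected.reachable_sdiff_edge {V : Type*} {G : SimpleGraph V}
    (hG : G.Connected) (u v z : V) :
    (G \ SimpleGraph.edge u v).Reachable u z ∨ (G \ SimpleGraph.edge u v).Reachable v z := by
  obtain ⟨w⟩ := hG.preconnected z u
  induction w with
  | nil => exact .inl .rfl
  | @cons a b c h p ih =>
    by_cases hedge : (SimpleGraph.edge c v).Adj a b
    · rw [SimpleGraph.edge_adj] at hedge
      rcases hedge with ⟨⟨rfl, rfl⟩ | ⟨rfl, rfl⟩, -⟩
      · exact .inl .rfl
      · exact .inr .rfl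
    · have hab : (G \ SimpleGraph.edge c v).Reachable b a :=
        SimpleGraph.Adj.reachable ⟨h.symm, fun h' => hedge h'.symm⟩
      exact ih.imp (·.trans hab) (·.trans hab)

/-- The cut property of minimum spanning trees: an edge is a shortest connection between the two
parts into which its deletion splits the tree. -/
theorem dist_le_of_reachable_sdiff_edge {V : Type*} [Fintype V] {n : ℕ}
    {pos : V → EuclideanSpace ℝ (Fin n)} {T : SimpleGraph V} (hT : T.Connected)
    (hmin : ∀ T', IsSpanningTree T' → graphWeight pos T ≤ graphWeight pos T')
    {u v x y : V} (huv : T.Adj u v) (hx : (T \ SimpleGraph.edge u v).Reachable u x)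
    (hy : (T \ SimpleGraph.edge u v).Reachable v y) :
    dist (pos u) (pos v) ≤ dist (pos x) (pos y) := by
  set D := T \ SimpleGraph.edge u v with hD
  set G := D ⊔ SimpleGraph.edge x y with hG
  have hDG : D ≤ G := le_sup_left
  have hxy : G.Reachable x y := by
    rcases eq_or_ne x y with rfl | hne
    · rfl
    · exact SimpleGraph.Adj.reachable (.inr ((SimpleGraph.edge_adj ..).2 ⟨.inl ⟨rfl, rfl⟩, hne⟩))
  have huvG : G.Reachable u v := ((hx.mono hDG).trans hxy).trans (hy.mono hDG).symm
  have hconn : G.Connected := by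
    have hreach (z : V) : G.Reachable u z := (hT.reachable_sdiff_edge u v z).elim
      (fun h => h.mono hDG) fun h => huvG.trans (h.mono hDG)
    have := hT.nonempty
    exact ⟨fun a b => (hreach a).symm.trans (hreach b)⟩
  have h1 := graphWeight_le_of_connected hmin hconn
  have h2 := graphWeight_sup_edge_le pos D x y
  have h3 := graphWeight_deleteEdge_add_dist pos huv
  linarith

/-- If the vertices can be visited in steps of length at most `δ`, then all edges of a minimum
spanning tree have length at most `δ`. -/
theorem dist_le_of_chain {V : Type*} [Fintype V] {n : ℕ}
    {pos : V → EuclideanSpace ℝ (Fin n)} {T : SimpleGraph V} (hT : T.Connected)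
    (hmin : ∀ T', IsSpanningTree T' → graphWeight pos T ≤ graphWeight pos T')
    {q : ℕ → V} (hq : Function.Surjective q) {δ : ℝ}
    (hstep : ∀ i, dist (pos (q i)) (pos (q (i + 1))) ≤ δ) {u v : V} (huv : T.Adj u v) :
    dist (pos u) (pos v) ≤ δ := by
  by_contra! hlt
  set D := T \ SimpleGraph.edge u v with hD
  have hδ : 0 ≤ δ := dist_nonneg.trans (hstep 0)
  have hcut {x y : V} (hx : D.Reachable u x) (hy : D.Reachable v y) : δ < dist (pos x) (pos y) :=
    hlt.trans_le (dist_le_of_reachable_sdiff_edge hT hmin huv hx hy)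
  have hnot {x : V} (hx : D.Reachable u x) (hy : D.Reachable v x) : False := by
    have := hcut hx hy
    rw [dist_self] at this
    linarith
  have hiff (i : ℕ) : D.Reachable u (q 0) ↔ D.Reachable u (q i) := by
    induction i with
    | zero => rfl
    | succ i ih =>
      rw [ih]
      have hs := hstep i
      constructor <;> intro h
      · refine (hT.reachable_sdiff_edge u v _).resolve_right fun h' => ?_
        exact (hcut h h').not_ge hs
      · refine (hT.reachable_sdiff_edge u v _).resolve_right fun h' => ?_
        rw [dist_comm] at hs
        exact (hcut h h').not_ge hs
  obtain ⟨i, rfl⟩ := hq u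
  obtain ⟨j, rfl⟩ := hq v
  exact hnot ((hiff j).1 ((hiff i).2 .rfl)) .rfl

/-- No vertex lies in the relative interior of an edge of a minimum spanning tree. -/
theorem notMem_openSegment_of_adj {V : Type*} [Fintype V] {n : ℕ}
    {pos : V → EuclideanSpace ℝ (Fin n)} (hpos : Function.Injective pos) {T : SimpleGraph V}
    (hT : T.Connected)
    (hmin : ∀ T', IsSpanningTree T' → graphWeight pos T ≤ graphWeight pos T')
    {u v : V} (huv : T.Adj u v) (z : V) : pos z ∉ openSegment ℝ (pos u) (pos v) := by
  intro hz
  rw [openSegment_eq_image_lineMap] at hz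
  obtain ⟨c, hc, hcz⟩ := hz
  have hd : 0 < dist (pos u) (pos v) := dist_pos.2 (hpos.ne huv.ne)
  rcases hT.reachable_sdiff_edge u v z with h | h
  · have := dist_le_of_reachable_sdiff_edge hT hmin huv h .rfl
    rw [← hcz, dist_lineMap_right, Real.norm_of_nonneg (by linarith [hc.2])] at this
    nlinarith [hc.1]
  · have := dist_le_of_reachable_sdiff_edge hT hmin huv .rfl h
    rw [← hcz, dist_left_lineMap, Real.norm_of_nonneg hc.1.le] at this
    nlinarith [hc.2]

/-- Distinct edges of a minimum spanning tree overlap in a null set. -/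
theorem hausdorffMeasure_segment_inter_segment_eq_zero {V : Type*} [Fintype V] {n : ℕ}
    {pos : V → EuclideanSpace ℝ (Fin n)} (hpos : Function.Injective pos) {T : SimpleGraph V}
    (hT : T.Connected)
    (hmin : ∀ T', IsSpanningTree T' → graphWeight pos T ≤ graphWeight pos T')
    {u v x y : V} (huv : T.Adj u v) (hxy : T.Adj x y) (hux : u ≠ x) (huy : u ≠ y) :
    μH[1] (segment ℝ (pos u) (pos v) ∩ segment ℝ (pos x) (pos y)) = 0 := by
  have hsub : (segment ℝ (pos u) (pos v) ∩ segment ℝ (pos x) (pos y)).Subsingleton := by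
    intro p hp q hq
    by_contra hpq
    rcases segment_overlap_cases hpq hp.1 hq.1 hp.2 hq.2 with h | h | h | h | h
    · exact notMem_openSegment_of_adj hpos hT hmin huv x h
    · exact notMem_openSegment_of_adj hpos hT hmin huv y h
    · exact notMem_openSegment_of_adj hpos hT hmin hxy u h
    · exact hux (hpos h)
    · exact huy (hpos h)
  rcases hsub.eq_empty_or_singleton with h | ⟨p, h⟩
  · rw [h, measure_empty]
  · rw [h, hausdorffMeasure_one_singleton]

/-- Visiting the vertices one after another gives a connected graph. -/
theorem exists_connected_graphWeight_le {V : Type*} [Fintype V] {n : ℕ}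
    (pos : V → EuclideanSpace ℝ (Fin n)) {p : ℕ → V} {N : ℕ} (hp : ∀ z, ∃ i ≤ N, p i = z) :
    ∃ G : SimpleGraph V, G.Connected ∧
      graphWeight pos G ≤ ∑ i ∈ Finset.range N, dist (pos (p i)) (pos (p (i + 1))) := by
  have key (M : ℕ) : ∃ G : SimpleGraph V, (∀ i ≤ M, G.Reachable (p 0) (p i)) ∧
      graphWeight pos G ≤ ∑ i ∈ Finset.range M, dist (pos (p i)) (pos (p (i + 1))) := by
    induction M with
    | zero =>
      refine ⟨⊥, fun i hi => ?_, by simp [graphWeight_bot]⟩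
      rw [Nat.le_zero.1 hi]
    | succ M ih =>
      obtain ⟨G, hreach, hw⟩ := ih
      refine ⟨G ⊔ SimpleGraph.edge (p M) (p (M + 1)), fun i hi => ?_, ?_⟩
      · rcases hi.lt_or_eq with h | rfl
        · exact (hreach i (Nat.lt_succ_iff.1 h)).mono le_sup_left
        · refine ((hreach M le_rfl).mono le_sup_left).trans ?_
          rcases eq_or_ne (p M) (p (M + 1)) with heq | hne
          · rw [← heq]
          · exact SimpleGraph.Adj.reachable
              (.inr ((SimpleGraph.edge_adj ..).2 ⟨.inl ⟨rfl, rfl⟩, hne⟩))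
      · rw [Finset.sum_range_succ]
        exact (graphWeight_sup_edge_le pos G _ _).trans (by linarith)
  obtain ⟨G, hreach, hw⟩ := key N
  have hreach' (z : V) : G.Reachable (p 0) z := by
    obtain ⟨i, hi, rfl⟩ := hp z
    exact hreach i hi
  have : Nonempty V := ⟨p 0⟩
  exact ⟨G, ⟨fun a b => (hreach' a).symm.trans (hreach' b)⟩, hw⟩

/-- A minimum spanning tree of points on a curve weighs at most the length of the curve. -/
theorem ofReal_graphWeight_le_eVariationOn {V : Type*} [Fintype V] [Nonempty V] {n : ℕ}
    {pos : V → EuclideanSpace ℝ (Fin n)} {T : SimpleGraph V}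
    (hmin : ∀ T', IsSpanningTree T' → graphWeight pos T ≤ graphWeight pos T')
    {f : ℝ → EuclideanSpace ℝ (Fin n)} {s : Set ℝ} {t : V → ℝ} (hts : ∀ x, t x ∈ s)
    (hft : ∀ x, f (t x) = pos x) :
    ENNReal.ofReal (graphWeight pos T) ≤ eVariationOn f s := by
  obtain ⟨N, hN⟩ : ∃ N, Fintype.card V = N + 1 :=
    Nat.exists_eq_succ_of_ne_zero Fintype.card_ne_zero
  let e : Fin (N + 1) ≃ V := (Fintype.equivFinOfCardEq hN).symm
  let σ := Tuple.sort (t ∘ e)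
  let p : ℕ → V := fun i => e (σ ⟨min i N, by omega⟩)
  have hp : ∀ z, ∃ i ≤ N, p i = z := by
    intro z
    have hlt := (σ.symm (e.symm z)).isLt
    refine ⟨σ.symm (e.symm z), by omega, ?_⟩
    have : (⟨min (σ.symm (e.symm z) : ℕ) N, by omega⟩ : Fin (N + 1)) = σ.symm (e.symm z) :=
      Fin.ext (by simp; omega)
    simp only [p, this, Equiv.apply_symm_apply]
  have hmono : Monotone (t ∘ p) := fun i j hij =>
    Tuple.monotone_sort (t ∘ e) (Fin.mk_le_mk.2 (min_le_min_right N hij))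
  obtain ⟨G, hG, hw⟩ := exists_connected_graphWeight_le pos hp
  calc ENNReal.ofReal (graphWeight pos T)
      ≤ ENNReal.ofReal (∑ i ∈ Finset.range N, dist (pos (p i)) (pos (p (i + 1)))) :=
        ENNReal.ofReal_le_ofReal ((graphWeight_le_of_connected hmin hG).trans hw)
    _ = ∑ i ∈ Finset.range N, edist (f ((t ∘ p) (i + 1))) (f ((t ∘ p) i)) := by
        rw [ENNReal.ofReal_sum_of_nonneg fun _ _ => dist_nonneg]
        refine Finset.sum_congr rfl fun i _ => ?_
        rw [← edist_dist, edist_comm, Function.comp_apply, Function.comp_apply, hft, hft]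
    _ ≤ eVariationOn f s := eVariationOn.sum_le hmono fun i => hts _

/-- If parameters of adjacent vertices differ by at most `η` and some vertices have parameters
within `η` of `0` and `1`, then the graph contains a path of length more than `v`. -/
theorem exists_isPath_lt_polyLength {V E : Type*} [MetricSpace E] {G : SimpleGraph V}
    (hG : G.Connected) {pos : V → E} {f : ℝ → E} {θ : V → ℝ} {v : ℝ≥0∞} {η : ℝ}
    (hφ : ∀ φ : ℝ → ℝ, (∀ t ∈ Icc (0 : ℝ) 1, φ t ∈ Icc (0 : ℝ) 1 ∧ |φ t - t| ≤ η) →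
      v < eVariationOn (f ∘ φ) (Icc 0 1))
    (hθ : ∀ x, θ x ∈ Icc (0 : ℝ) 1) (hf : ∀ x, f (θ x) = pos x)
    (hadj : ∀ x y, G.Adj x y → |θ x - θ y| ≤ η) {x₀ x₁ : V} (h₀ : θ x₀ ≤ η)
    (h₁ : 1 - η ≤ θ x₁) :
    ∃ w : G.Walk x₀ x₁, w.IsPath ∧ v < ENNReal.ofReal (polyLength (w.support.map pos)) := by
  obtain ⟨w, hw⟩ := (hG.preconnected x₀ x₁).exists_isPath
  refine ⟨w, hw, ?_⟩
  obtain ⟨j, hj, hjM, hjt⟩ := exists_monotone_abs_sub_le (s := fun i => θ (w.getVert i))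
    (M := w.length) (η := η) (by simpa using h₀) (hθ _).1 (by simpa using h₁)
    (fun i hi => hadj _ _ (w.adj_getVert_succ hi).symm)
  have hcomp : f ∘ (fun t => θ (w.getVert (j t))) = (fun i => pos (w.getVert i)) ∘ j := by
    ext t
    simp [hf]
  refine (hφ (fun t => θ (w.getVert (j t))) fun t ht => ⟨hθ _, hjt t ht⟩).trans_le ?_
  rw [hcomp]
  refine (eVariationOn_comp_monotone_le _ hj hjM _).trans ?_
  rw [polyLength_map_support, ENNReal.ofReal_sum_of_nonneg fun _ _ => dist_nonneg]
  simp only [edist_dist, le_refl]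

/-- A dissection of `[0, 1]` of mesh less than `ρ` has points within `ρ` of every point. -/
theorem exists_abs_sub_lt_of_mesh_lt {b : ℕ → ℝ} {k : ℕ} {ρ : ℝ} (hρ : 0 < ρ) (hb0 : b 0 = 0)
    (hbk : b k = 1) (hmesh : ∀ i, b (i + 1) - b i < ρ) {x : ℝ} (hx : x ∈ Icc (0 : ℝ) 1) :
    ∃ i, |b i - x| < ρ := by
  have hex : ∃ i, x ≤ b i := ⟨k, hbk ▸ hx.2⟩
  have h := Nat.find_spec hex
  rcases hi : Nat.find hex with _ | i
  · rw [hi, hb0] at h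
    exact ⟨0, by rw [hb0, abs_lt]; constructor <;> linarith [hx.1]⟩
  · have hlt := Nat.find_min hex (m := i) (by omega)
    rw [hi] at h
    exact ⟨i + 1, by rw [abs_lt]; constructor <;> linarith [hmesh i]⟩

theorem lmst_length_tendsto_curve_length {n : ℕ}
    (γ : ℝ → EuclideanSpace ℝ (Fin n)) (hγ : ContinuousOn γ (Icc 0 1))
    (Γ : Set (EuclideanSpace ℝ (Fin n))) (hΓ : Γ = γ '' Icc 0 1)
    -- Γ is a simple rectifiable curve (though γ itself need not be injective):
    (γ' : ℝ → EuclideanSpace ℝ (Fin n)) (hγ'c : ContinuousOn γ' (Icc 0 1))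
    (hγ'i : InjOn γ' (Icc 0 1)) (hγ'im : γ' '' Icc 0 1 = Γ) (hrect : μH[1] Γ < ⊤)
    -- a sequence of dissections of [0,1]:
    (k : ℕ → ℕ) (a : (m : ℕ) → Fin (k m + 1) → ℝ)
    (hmono : ∀ m, StrictMono (a m))
    (h0 : ∀ m, a m 0 = 0) (h1 : ∀ m, a m (Fin.last (k m)) = 1)
    -- mesh of the dissections tends to 0:
    (hmesh : ∀ ε > (0 : ℝ), ∃ N, ∀ m ≥ N, ∀ i : Fin (k m),
      a m i.succ - a m i.castSucc < ε)
    -- sampled point sets: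
    (S : ℕ → Finset (EuclideanSpace ℝ (Fin n)))
    (hS : ∀ m, (S m : Set (EuclideanSpace ℝ (Fin n))) = Set.range (fun i => γ (a m i)))
    -- minimum Euclidean spanning trees of the samples:
    (T : (m : ℕ) → SimpleGraph {x // x ∈ S m})
    (hT : ∀ m, IsSpanningTree (T m))
    (hTmin : ∀ m, ∀ T' : SimpleGraph {x // x ∈ S m}, IsSpanningTree T' →
      graphWeight (fun x : {x // x ∈ S m} => (x : EuclideanSpace ℝ (Fin n))) (T m) ≤
        graphWeight (fun x : {x // x ∈ S m} => (x : EuclideanSpace ℝ (Fin n))) T')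
    -- longest paths inside the minimum spanning trees:
    (L : ℕ → Set (EuclideanSpace ℝ (Fin n)))
    (hL : ∀ m, ∃ (u v : {x // x ∈ S m}) (w : (T m).Walk u v), w.IsPath ∧
      (∀ (u' v' : {x // x ∈ S m}) (w' : (T m).Walk u' v'), w'.IsPath →
        polyLength (w'.support.map (fun x => (x : EuclideanSpace ℝ (Fin n)))) ≤
          polyLength (w.support.map (fun x => (x : EuclideanSpace ℝ (Fin n))))) ∧
      L m = polySet (w.support.map (fun x => (x : EuclideanSpace ℝ (Fin n))))) :
    Tendsto (fun m => μH[1] (L m)) atTop (nhds (μH[1] Γ)) := by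
  subst hΓ
  have hlen : μH[1] (γ '' Icc 0 1) = eVariationOn γ' (Icc 0 1) := by
    rw [← hγ'im]
    exact le_antisymm (hausdorffMeasure_image_le_eVariationOn γ' zero_le_one)
      (eVariationOn_le_hausdorffMeasure_image ordConnected_Icc hγ'c hγ'i)
  have ha (m : ℕ) (i : Fin (k m + 1)) : a m i ∈ Icc (0 : ℝ) 1 :=
    ⟨h0 m ▸ (hmono m).monotone (Fin.zero_le i), h1 m ▸ (hmono m).monotone (Fin.le_last i)⟩
  have hmem (m : ℕ) (i : Fin (k m + 1)) : γ (a m i) ∈ S m := by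
    rw [← Finset.mem_coe, hS]
    exact mem_range_self i
  have hparam (m : ℕ) (x : {x // x ∈ S m}) : ∃ t ∈ Icc (0 : ℝ) 1, γ' t = x := by
    have hx : (x : EuclideanSpace ℝ (Fin n)) ∈ (S m : Set (EuclideanSpace ℝ (Fin n))) := x.2
    rw [hS] at hx
    obtain ⟨i, hi⟩ := hx
    have : (x : EuclideanSpace ℝ (Fin n)) ∈ γ' '' Icc 0 1 := by
      rw [hγ'im, ← hi]
      exact mem_image_of_mem γ (ha m i)
    exact this
  choose θ hθ hθx using hparam
  have hsupport (m : ℕ) (l : List {x // x ∈ S m}) :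
      List.map (fun x => x) (l >>= fun x => pure (x : EuclideanSpace ℝ (Fin n))) =
        l.map Subtype.val := by
    rw [List.map_id', List.bind_eq_flatMap]
    exact List.map_eq_flatMap.symm
  choose u v w hw hmax hLm using hL
  simp only [hsupport] at hmax hLm
  have hLeq (m : ℕ) : μH[1] (L m) =
      ENNReal.ofReal
      (polyLength ((w m).support.map Subtype.val)) := by
    rw [hLm]
    exact hausdorffMeasure_polySet_eq _ (fun _ _ _ _ =>
      hausdorffMeasure_segment_inter_segment_eq_zero Subtype.val_injective (hT m).1 (hTmin m))
      _ (hw m)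
  have hle (m : ℕ) : μH[1] (L m) ≤ eVariationOn γ' (Icc 0 1) := by
    have : Nonempty {x // x ∈ S m} := ⟨u m⟩
    rw [hLeq]
    exact (ENNReal.ofReal_le_ofReal (polyLength_map_support_le_graphWeight _ _ (hw m))).trans
      (ofReal_graphWeight_le_eVariationOn (hTmin m) (hθ m) (hθx m))
  rw [hlen]
  refine tendsto_order.2 ⟨fun c hc => ?_, fun c hc => .of_forall fun m => (hle m).trans_lt hc⟩
  obtain ⟨η, hη, hφ⟩ := exists_pos_forall_lt_eVariationOn_comp hγ'c hc
  obtain ⟨δ, hδ, hinv⟩ := exists_pos_forall_dist_lt_imp_abs_sub_lt hγ'c hγ'i hη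
  obtain ⟨ρ, hρ, huc⟩ := Metric.uniformContinuousOn_iff.1
    (isCompact_Icc.uniformContinuousOn_of_continuous hγ) (δ / 2) (half_pos hδ)
  obtain ⟨N, hN⟩ := hmesh ρ hρ
  filter_upwards [eventually_ge_atTop N] with m hm
  let b : ℕ → Fin (k m + 1) := fun i => ⟨min i (k m), by omega⟩
  have hb0 : a m (b 0) = 0 := by
    rw [← h0 m]
    congr 1
  have hbk : a m (b (k m)) = 1 := by
    rw [← h1 m]
    congr 1
    simp [b, Fin.ext_iff]
  have hstep (i : ℕ) : 0 ≤ a m (b (i + 1)) - a m (b i) ∧ a m (b (i + 1)) - a m (b i) < ρ := by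
    refine ⟨sub_nonneg.2 ((hmono m).monotone (Fin.mk_le_mk.2 (by omega))), ?_⟩
    rcases lt_or_ge i (k m) with hi | hi
    · have := hN m hm ⟨i, hi⟩
      have e1 : b (i + 1) = Fin.succ ⟨i, hi⟩ := by simp [b, Fin.ext_iff]; omega
      have e2 : b i = Fin.castSucc ⟨i, hi⟩ := by simp [b, Fin.ext_iff]; omega
      rwa [e1, e2]
    · have e : b (i + 1) = b i := by simp [b, Fin.ext_iff]; omega
      rwa [e, sub_self]
  let q : ℕ → {x // x ∈ S m} := fun i => ⟨γ (a m (b i)), hmem m _⟩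
  have hq : Function.Surjective q := by
    rintro ⟨x, hx⟩
    have hx' : x ∈ (S m : Set (EuclideanSpace ℝ (Fin n))) := hx
    rw [hS] at hx'
    obtain ⟨i, rfl⟩ := hx'
    have hbi : b i = i := by
      have := i.2
      simp [b, Fin.ext_iff]
      omega
    exact ⟨i, Subtype.ext (by simp only [q, hbi])⟩
  have hqstep (i : ℕ) : dist (q i : EuclideanSpace ℝ (Fin n)) (q (i + 1)) ≤ δ / 2 := by
    refine (huc _ (ha m _) _ (ha m _) ?_).le
    rw [Real.dist_eq, abs_sub_comm, abs_of_nonneg (hstep i).1]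
    exact (hstep i).2
  have hadj (x y : {x // x ∈ S m}) (hxy : (T m).Adj x y) : |θ m x - θ m y| ≤ η := by
    refine (hinv _ (hθ m x) _ (hθ m y) ?_).le
    rw [hθx, hθx]
    exact (dist_le_of_chain (hT m).1 (hTmin m) hq hqstep hxy).trans_lt (half_lt_self hδ)
  have hnear {s : ℝ} (hs : s ∈ Icc (0 : ℝ) 1) : ∃ x, |θ m x - s| < η := by
    obtain ⟨r, hr, hrs⟩ : γ' s ∈ γ '' Icc 0 1 := hγ'im ▸ mem_image_of_mem γ' hs
    obtain ⟨i, hi⟩ := exists_abs_sub_lt_of_mesh_lt (b := fun i => a m (b i)) hρ hb0 hbk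
      (fun i => (hstep i).2) hr
    refine ⟨q i, hinv _ (hθ m _) _ hs ?_⟩
    rw [hθx, ← hrs]
    exact (huc _ (ha m _) _ hr hi).trans (half_lt_self hδ)
  obtain ⟨x₀, hx₀⟩ := hnear ⟨le_rfl, zero_le_one⟩
  obtain ⟨x₁, hx₁⟩ := hnear ⟨zero_le_one, le_rfl⟩
  obtain ⟨p, hp, hlt⟩ := exists_isPath_lt_polyLength (hT m).1 hφ (hθ m) (hθx m) hadj
    (x₀ := x₀) (x₁ := x₁) (by linarith [(abs_lt.1 hx₀).2]) (by linarith [(abs_lt.1 hx₁).1])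
  rw [hLeq]
  exact hlt.trans_le (ENNReal.ofReal_le_ofReal (hmax m _ _ p hp))
end
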